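/- If an empirical model e is noncontextual (i.e., extends to a probability measure on the global outcome space whose marginals are the e_C), then NCF(e) = 1; conversely, if NCF(e) = 1 then the supremum defining NCF is attained by a global probability measure extending e, so e is noncontextual. Hence CF(e) = 0 if and only if e is extendable. -/

import Mathlib

open MeasureTheory
open scoped ENNReal

/-- The projection from the global outcome space onto the outcomes of a context `C`. -/
def proj {X : Type*} {O : X → Type*} (C : Set X) (g : ∀ x, O x) : ∀ x : C, O x :=
  fun x => g x

/-- The noncontextual fraction. -/
noncomputable def NCF {G : Type*} [MeasurableSpace G] {I : Type*} (M : Finset I)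
    {Gc : I → Type*} [∀ i, MeasurableSpace (Gc i)] (π : ∀ i, G → Gc i)
    (e : ∀ i, Measure (Gc i)) : ℝ≥0∞ :=
  sSup { r | ∃ μ : Measure G, (∀ i ∈ M, μ.map (π i) ≤ e i) ∧ r = μ Set.univ }

theorem measurable_proj {X : Type*} {O : X → Type*} [∀ x, MeasurableSpace (O x)] (C : Set X) :
    Measurable (proj C (O := O)) :=
  measurable_pi_lambda _ fun x => measurable_pi_apply (x : X)

theorem continuous_proj {X : Type*} {O : X → Type*} [∀ x, TopologicalSpace (O x)] (C : Set X) :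
    Continuous (proj C (O := O)) :=
  continuous_pi fun x => continuous_apply (x : X)

theorem measure_univ_le_of_map_le {G H : Type*} [MeasurableSpace G] [MeasurableSpace H]
    {μ : Measure G} {f : G → H} (hf : Measurable f) {ν : Measure H} (h : μ.map f ≤ ν) :
    μ Set.univ ≤ ν Set.univ := by
  simpa [Measure.map_apply hf MeasurableSet.univ] using h Set.univ

theorem NCF_le_one {G I : Type*} [MeasurableSpace G] {M : Finset I} (hM : M.Nonempty)
    {Gc : I → Type*} [∀ i, MeasurableSpace (Gc i)] {π : ∀ i, G → Gc i}
    (hπ : ∀ i ∈ M, Measurable (π i)) {e : ∀ i, Measure (Gc i)}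
    (he : ∀ i ∈ M, IsProbabilityMeasure (e i)) : NCF M π e ≤ 1 := by
  obtain ⟨i, hi⟩ := hM
  refine sSup_le ?_
  rintro r ⟨μ, hμ, rfl⟩
  exact (measure_univ_le_of_map_le (hπ i hi) (hμ i hi)).trans_eq (he i hi).measure_univ

/-- A family of measures on a finite product whose one-dimensional marginals are all dominated by
fixed tight finite measures is tight. -/
theorem isTightMeasureSet_of_map_eval_le {X : Type*} [Fintype X] {O : X → Type*}
    [∀ x, TopologicalSpace (O x)] [∀ x, T2Space (O x)]
    [∀ x, MeasurableSpace (O x)] [∀ x, BorelSpace (O x)]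
    (lam : ∀ x, Measure (O x)) (hlam : ∀ x, IsTightMeasureSet {lam x}) :
    IsTightMeasureSet {ν : Measure (∀ x, O x) | ∀ x, ν.map (fun g => g x) ≤ lam x} := by
  simp only [isTightMeasureSet_iff_exists_isCompact_measure_compl_le] at hlam ⊢
  intro ε hε
  obtain ⟨δ, hδ, hδε⟩ := ENNReal.exists_pos_sum_of_countable' hε.ne' X
  choose K hK hKδ using fun x => hlam x (δ x) (hδ x)
  refine ⟨Set.univ.pi K, isCompact_univ_pi hK, fun ν hν => ?_⟩
  have hcompl : (Set.univ.pi K)ᶜ = ⋃ x, (fun g : ∀ x, O x => g x) ⁻¹' (K x)ᶜ := by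
    ext g
    simp
  calc ν (Set.univ.pi K)ᶜ
      ≤ ∑' x, ν ((fun g : ∀ x, O x => g x) ⁻¹' (K x)ᶜ) := hcompl ▸ measure_iUnion_le _
    _ ≤ ∑' x, δ x := by
        refine ENNReal.tsum_le_tsum fun x => ?_
        rw [← Measure.map_apply (measurable_pi_apply x) (hK x).measurableSet.compl]
        exact (hν x _).trans (hKδ x _ rfl)
    _ ≤ ε := hδε.le

/-- If the marginals of a weakly convergent net of probability measures are dominated by multiples
of a probability measure `e`, with factors tending to `1`, then the marginal of the limit is `e`. -/
theorem map_eq_of_tendsto_of_map_le {G H ι : Type*}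
    [TopologicalSpace G] [MeasurableSpace G] [OpensMeasurableSpace G]
    [TopologicalSpace H] [MeasurableSpace H] [BorelSpace H] [HasOuterApproxClosed H]
    {f : G → H} (hf : Continuous f) (hfm : Measurable f)
    {e : Measure H} [IsProbabilityMeasure e] [e.OuterRegular]
    {L : Filter ι} [L.NeBot] {ν : ι → ProbabilityMeasure G} {ν₀ : ProbabilityMeasure G}
    (hν : Filter.Tendsto ν L (nhds ν₀)) {c : ι → ℝ≥0∞} (hc : Filter.Tendsto c L (nhds 1))
    (hle : ∀ i, (ν i : Measure G).map f ≤ c i • e) :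
    (ν₀ : Measure G).map f = e := by
  have hopen : ∀ U, IsOpen U → (ν₀ : Measure G).map f U ≤ e U := by
    intro U hU
    have hlim := ProbabilityMeasure.le_liminf_measure_open_of_tendsto
      (ProbabilityMeasure.tendsto_map_of_tendsto_of_continuous ν ν₀ hν hf) hU
    have hcU : Filter.Tendsto (fun i => c i * e U) L (nhds (e U)) := by
      simpa using ENNReal.Tendsto.mul_const hc (Or.inl one_ne_zero)
    refine hlim.trans (le_of_le_of_eq (Filter.liminf_le_liminf ?_) hcU.liminf_eq)
    exact Filter.Eventually.of_forall fun i => hle i U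
  have hmap : IsProbabilityMeasure ((ν₀ : Measure G).map f) :=
    Measure.isProbabilityMeasure_map hfm.aemeasurable
  refine Measure.eq_of_le_of_measure_univ_eq (Measure.le_iff.2 fun A _ => ?_)
    (by rw [measure_univ, measure_univ])
  rw [Set.measure_eq_iInf_isOpen A e]
  exact le_iInf₂ fun U hAU => le_iInf fun hU => (measure_mono hAU).trans (hopen U hU)

open Classical in
/-- The map of the global outcome space that resets to `a` the coordinates outside `S`. -/
noncomputable def resetOutside {X : Type*} {O : X → Type*} (S : Set X) (a g : ∀ x, O x) :
    ∀ x, O x :=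
  fun x => if x ∈ S then g x else a x

theorem resetOutside_of_mem {X : Type*} {O : X → Type*} {S : Set X} (a g : ∀ x, O x) {x : X}
    (hx : x ∈ S) : resetOutside S a g x = g x :=
  if_pos hx

theorem resetOutside_of_notMem {X : Type*} {O : X → Type*} {S : Set X} (a g : ∀ x, O x) {x : X}
    (hx : x ∉ S) : resetOutside S a g x = a x :=
  if_neg hx

theorem measurable_resetOutside {X : Type*} {O : X → Type*} [∀ x, MeasurableSpace (O x)]
    (S : Set X) (a : ∀ x, O x) : Measurable (resetOutside S a) := by
  refine measurable_pi_lambda _ fun x => ?_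
  by_cases hx : x ∈ S
  · simpa only [resetOutside_of_mem _ _ hx] using measurable_pi_apply x
  · simpa only [resetOutside_of_notMem _ _ hx] using measurable_const

theorem proj_comp_resetOutside {X : Type*} {O : X → Type*} {S C : Set X} (h : C ⊆ S)
    (a : ∀ x, O x) : proj C ∘ resetOutside S a = proj C :=
  funext fun g => funext fun x => resetOutside_of_mem a g (h x.2)

/-- A family of probability measures whose marginals on the contexts are dominated by
multiples of `e` with factors tending to `1` gives rise to an extension of `e`. -/
theorem exists_extension_of_map_proj_le {X : Type*} [Fintype X] {O : X → Type*}
    [∀ x, TopologicalSpace (O x)] [∀ x, SecondCountableTopology (O x)]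
    [∀ x, LocallyCompactSpace (O x)] [∀ x, T2Space (O x)]
    [∀ x, MeasurableSpace (O x)] [∀ x, BorelSpace (O x)]
    (M : Finset (Set X)) (e : ∀ C : Set X, Measure (∀ x : C, O x))
    (he : ∀ C ∈ M, IsProbabilityMeasure (e C))
    (ν : ℕ → Measure (∀ x, O x)) (hν : ∀ n, IsProbabilityMeasure (ν n))
    (c : ℕ → ℝ≥0∞) (hc : Filter.Tendsto c Filter.atTop (nhds 1)) (hc2 : ∀ n, c n ≤ 2)
    (hle : ∀ n, ∀ C ∈ M, (ν n).map (proj C) ≤ c n • e C) :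
    ∃ μ : Measure (∀ x, O x), IsProbabilityMeasure μ ∧ ∀ C ∈ M, μ.map (proj C) = e C := by
  obtain ⟨a⟩ : Nonempty (∀ x, O x) :=
    nonempty_of_isProbabilityMeasure (ν 0)
  let S : Set X := ⋃ C ∈ M, C
  have hCS : ∀ C ∈ M, C ⊆ S := fun C hC => Set.subset_biUnion_of_mem (u := id) hC
  have hrm := measurable_resetOutside S a
  let ρ : ℕ → ProbabilityMeasure (∀ x, O x) := fun n =>
    ⟨(ν n).map (resetOutside S a), Measure.isProbabilityMeasure_map hrm.aemeasurable⟩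
  have hρle : ∀ n, ∀ C ∈ M, (ρ n : Measure (∀ x, O x)).map (proj C) ≤ c n • e C := by
    intro n C hC
    change ((ν n).map (resetOutside S a)).map (proj C) ≤ _
    rw [Measure.map_map (measurable_proj C) hrm, proj_comp_resetOutside (hCS C hC)]
    exact hle n C hC
  have hmarg : ∀ x, ∃ lam : Measure (O x), IsFiniteMeasure lam ∧
      ∀ n, (ρ n : Measure (∀ x, O x)).map (fun g => g x) ≤ lam := by
    intro x
    by_cases hx : x ∈ S
    · obtain ⟨C, hC, hxC⟩ := Set.mem_iUnion₂.1 hx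
      have := he C hC
      have hev : Measurable fun g : ∀ y : C, O y => g ⟨x, hxC⟩ := measurable_pi_apply _
      refine ⟨((2 : ℝ≥0∞) • e C).map (fun g => g ⟨x, hxC⟩), ?_, fun n => ?_⟩
      · have := (e C).smul_finite (c := 2) (by simp)
        infer_instance
      · have hcomp : (fun g : ∀ x, O x => g x)
            = (fun g : ∀ y : C, O y => g ⟨x, hxC⟩) ∘ proj C := rfl
        rw [hcomp, ← Measure.map_map hev (measurable_proj C)]
        refine Measure.map_mono ((hρle n C hC).trans ?_) hev
        gcongr
        exact hc2 n
    · refine ⟨Measure.dirac (a x), inferInstance, fun n => ?_⟩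
      change ((ν n).map (resetOutside S a)).map (fun g => g x) ≤ _
      rw [Measure.map_map (measurable_pi_apply x) hrm]
      have hconst : (fun g : ∀ x, O x => g x) ∘ resetOutside S a = fun _ => a x :=
        funext fun g => resetOutside_of_notMem a g hx
      rw [hconst, Measure.map_const, (hν n).measure_univ, one_smul]
  choose lam hlam hρlam using hmarg
  have htight : IsTightMeasureSet
      {((μ : ProbabilityMeasure (∀ x, O x)) : Measure (∀ x, O x)) | μ ∈ Set.range ρ} := by
    refine (isTightMeasureSet_of_map_eval_le lam
      fun x => isTightMeasureSet_singleton_of_innerRegular).subset ?_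
    rintro _ ⟨_, ⟨n, rfl⟩, rfl⟩ x
    exact hρlam x n
  have hcpt := isCompact_closure_of_isTightMeasureSet htight
  obtain ⟨μ, -, hμ⟩ := hcpt.ultrafilter_le_nhds ((Filter.hyperfilter ℕ).map ρ)
    (Filter.le_principal_iff.2 (Filter.mem_map.2 (Filter.univ_mem' fun n =>
      subset_closure ⟨n, rfl⟩)))
  have hμ' : Filter.Tendsto ρ (Filter.hyperfilter ℕ) (nhds μ) := hμ
  refine ⟨μ, inferInstance, fun C hC => ?_⟩
  have := he C hC
  exact map_eq_of_tendsto_of_map_le (L := Filter.hyperfilter ℕ) (continuous_proj C)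
    (measurable_proj C) hμ' (hc.mono_left Nat.hyperfilter_le_atTop)
    fun n => hρle n C hC

theorem exists_extension_of_one_le_NCF {X : Type*} [Fintype X] {O : X → Type*}
    [∀ x, TopologicalSpace (O x)] [∀ x, SecondCountableTopology (O x)]
    [∀ x, LocallyCompactSpace (O x)] [∀ x, T2Space (O x)]
    [∀ x, MeasurableSpace (O x)] [∀ x, BorelSpace (O x)]
    (M : Finset (Set X)) (hM : M.Nonempty) (e : ∀ C : Set X, Measure (∀ x : C, O x))
    (he : ∀ C ∈ M, IsProbabilityMeasure (e C))
    (h : 1 ≤ NCF M (fun C : Set X => proj C (O := O)) e) :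
    ∃ μ : Measure (∀ x, O x), IsProbabilityMeasure μ ∧ ∀ C ∈ M, μ.map (proj C) = e C := by
  obtain ⟨u, -, hu, hu1⟩ := exists_seq_strictMono_tendsto' (ENNReal.one_half_lt_one)
  have hμ : ∀ n, ∃ μ : Measure (∀ x, O x),
      (∀ C ∈ M, μ.map (proj C) ≤ e C) ∧ u n < μ Set.univ := by
    intro n
    obtain ⟨_, ⟨μ, hμ, rfl⟩, hlt⟩ := exists_lt_of_lt_csSup' ((hu n).2.trans_le h)
    exact ⟨μ, hμ, hlt⟩
  choose μ hμe hμu using hμ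
  obtain ⟨C₀, hC₀⟩ := hM
  have hμ1 : ∀ n, μ n Set.univ ≤ 1 := fun n =>
    (measure_univ_le_of_map_le (measurable_proj C₀) (hμe n C₀ hC₀)).trans_eq
      (he C₀ hC₀).measure_univ
  have hlim : Filter.Tendsto (fun n => μ n Set.univ) Filter.atTop (nhds 1) :=
    tendsto_of_tendsto_of_tendsto_of_le_of_le hu1 tendsto_const_nhds (fun n => (hμu n).le) hμ1
  refine exists_extension_of_map_proj_le M e he (fun n => (μ n Set.univ)⁻¹ • μ n) (fun n => ?_)
    (fun n => (μ n Set.univ)⁻¹) (by simpa using hlim.inv) (fun n => ?_) (fun n C hC => ?_)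
  · refine ⟨?_⟩
    rw [Measure.smul_apply, smul_eq_mul]
    exact ENNReal.inv_mul_cancel (bot_lt_of_lt (hμu n)).ne' ((hμ1 n).trans_lt ENNReal.one_lt_top).ne
  · rw [ENNReal.inv_le_iff_inv_le]
    exact (((hu n).1.trans (hμu n)).le).trans' (by simp)
  · rw [Measure.map_smul]
    gcongr
    exact hμe n C hC

/-- an empirical model (on second-countable locally compact Hausdorff
Borel outcome spaces) is noncontextual, i.e. extends to a global probability measure,
if and only if its noncontextual fraction is `1`; equivalently iff its contextual
fraction `1 - NCF` is `0`. -/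
theorem ncf_eq_one_iff_extendable {X : Type*} [Fintype X] {O : X → Type*}
    [∀ x, TopologicalSpace (O x)] [∀ x, SecondCountableTopology (O x)]
    [∀ x, LocallyCompactSpace (O x)] [∀ x, T2Space (O x)]
    [∀ x, MeasurableSpace (O x)] [∀ x, BorelSpace (O x)]
    (M : Finset (Set X)) (hM : M.Nonempty)
    (e : ∀ C : Set X, Measure (∀ x : C, O x))
    (he : ∀ C ∈ M, IsProbabilityMeasure (e C)) :
    ((∃ μ : Measure (∀ x, O x), IsProbabilityMeasure μ ∧
        ∀ C ∈ M, μ.map (proj C) = e C) ↔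
      NCF M (fun C : Set X => proj C (O := O)) e = 1) ∧
    ((∃ μ : Measure (∀ x, O x), IsProbabilityMeasure μ ∧
        ∀ C ∈ M, μ.map (proj C) = e C) ↔
      1 - NCF M (fun C : Set X => proj C (O := O)) e = 0) := by
  have hle : NCF M (fun C : Set X => proj C (O := O)) e ≤ 1 :=
    NCF_le_one hM (fun C _ => measurable_proj C) he
  have hiff : (∃ μ : Measure (∀ x, O x), IsProbabilityMeasure μ ∧
      ∀ C ∈ M, μ.map (proj C) = e C) ↔ 1 ≤ NCF M (fun C : Set X => proj C (O := O)) e := by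
    refine ⟨?_, exists_extension_of_one_le_NCF M hM e he⟩
    rintro ⟨μ, hμ, h⟩
    exact le_sSup ⟨μ, fun C hC => (h C hC).le, hμ.measure_univ.symm⟩
  exact ⟨hiff.trans hle.ge_iff_eq, hiff.trans tsub_eq_zero_iff_le.symm⟩
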